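/- Let f₁, f₂ : [−1,1] → ℝ be measurable with 0 < f_i(μ) < 1 for almost every μ ∈ [−1,1] (i = 1, 2). For i = 1, 2 set J_i = ⟨f_i⟩, H_i = ⟨μ f_i⟩, K_i = ⟨μ² f_i⟩, where ⟨g⟩ = (1/2)∫_{−1}^{1} g(μ) dμ. Then the sum Φ⁺[f₁] + Φ⁻[f₂] = ( (J₁+H₁)/2 + (J₂−H₂)/2 , (H₁+K₁)/2 + (H₂−K₂)/2 ) belongs to the fermionic realizable set 𝓡_1. -/

import Mathlib

open MeasureTheory

/-- `𝓡_1` viewed as a subset of `ℝ × ℝ`. -/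
def realizableSet₁ : Set (ℝ × ℝ) :=
  {M | 0 < M.1 ∧ M.1 < 1 ∧ |M.2| < M.1 * (1 - M.1)}

theorem aux_pos (h : ℝ → ℝ) (hi : IntegrableOn h (Set.Icc (-1 : ℝ) 1))
    (hp : ∀ᵐ μ ∂(volume.restrict (Set.Icc (-1 : ℝ) 1)), 0 < h μ) :
    0 < ∫ μ in Set.Icc (-1 : ℝ) 1, h μ := by
  have h0 : 0 ≤ᵐ[volume.restrict (Set.Icc (-1 : ℝ) 1)] h := hp.mono fun x hx => hx.le
  refine lt_of_le_of_ne (integral_nonneg_of_ae h0) fun he => ?_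
  have h1 := (integral_eq_zero_iff_of_nonneg_ae h0 hi).1 he.symm
  have h2 : ∀ᵐ μ ∂(volume.restrict (Set.Icc (-1 : ℝ) 1)), False := by
    filter_upwards [hp, h1] with x hx hy
    simp only [Pi.zero_apply] at hy
    linarith
  have h3 : volume.restrict (Set.Icc (-1 : ℝ) 1) = 0 := by
    exact ae_eq_bot.1 (Filter.eventually_false_iff_eq_bot.1 h2)
  rw [Measure.restrict_eq_zero, Real.volume_Icc] at h3
  norm_num at h3

theorem aux_max (c : ℝ) (h1 : -1 ≤ c) (h2 : c ≤ 1) :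
    ∫ μ in Set.Icc (-1 : ℝ) 1, max (μ - c) 0 = (1 - c) ^ 2 / 2 := by
  rw [integral_Icc_eq_integral_Ioc, ← intervalIntegral.integral_of_le (by norm_num)]
  have hc : Continuous fun μ : ℝ => max (μ - c) 0 := by fun_prop
  rw [← intervalIntegral.integral_add_adjacent_intervals (hc.intervalIntegrable (-1) c)
    (hc.intervalIntegrable c 1)]
  have e1 : ∫ μ in (-1 : ℝ)..c, max (μ - c) 0 = ∫ μ in (-1 : ℝ)..c, (0 : ℝ) := by
    apply intervalIntegral.integral_congr
    intro x hx
    rw [Set.uIcc_of_le h1] at hx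
    exact max_eq_right (by linarith [hx.2])
  have e2 : ∫ μ in c..(1 : ℝ), max (μ - c) 0 = ∫ μ in c..(1 : ℝ), (μ - c) := by
    apply intervalIntegral.integral_congr
    intro x hx
    rw [Set.uIcc_of_le h2] at hx
    exact max_eq_left (by linarith [hx.1])
  rw [e1, e2, intervalIntegral.integral_sub (by simp) (by simp)]
  simp
  ring

theorem aux_real (g : ℝ → ℝ) (hg : Measurable g)
    (hb : ∀ᵐ μ ∂(volume.restrict (Set.Icc (-1 : ℝ) 1)), 0 < g μ ∧ g μ < 1) :
    ((1 / 2) * ∫ μ in Set.Icc (-1 : ℝ) 1, g μ, (1 / 2) * ∫ μ in Set.Icc (-1 : ℝ) 1, μ * g μ)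
      ∈ realizableSet₁ := by
  have ig : IntegrableOn g (Set.Icc (-1 : ℝ) 1) := by
    refine Measure.integrableOn_of_bounded (M := 1) (by simp) hg.aestronglyMeasurable ?_
    filter_upwards [hb] with x hx
    rw [Real.norm_eq_abs, abs_of_pos hx.1]
    exact hx.2.le
  have im : IntegrableOn (fun μ => μ * g μ) (Set.Icc (-1 : ℝ) 1) :=
    ig.continuousOn_mul continuousOn_id isCompact_Icc
  have hJ0 := aux_pos g ig (hb.mono fun x hx => hx.1)
  have i1 : IntegrableOn (fun _ => (1 : ℝ)) (Set.Icc (-1 : ℝ) 1) := by simp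
  have ix : IntegrableOn (fun x : ℝ => x) (Set.Icc (-1 : ℝ) 1) :=
    continuous_id.continuousOn.integrableOn_Icc
  have hJ1 := aux_pos (fun μ => 1 - g μ) (i1.sub ig) (hb.mono fun x hx => by linarith [hx.2])
  rw [integral_sub i1 ig] at hJ1
  have e1 : ∫ μ in Set.Icc (-1 : ℝ) 1, (1 : ℝ) = 2 := by simp; norm_num
  have ex : ∫ μ in Set.Icc (-1 : ℝ) 1, μ = 0 := by
    rw [integral_Icc_eq_integral_Ioc, ← intervalIntegral.integral_of_le (by norm_num)]
    simp
  rw [e1] at hJ1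
  have key : ∀ c : ℝ, ∀ᵐ μ ∂(volume.restrict (Set.Icc (-1 : ℝ) 1)), μ ≠ c := fun c =>
    ae_restrict_of_ae (Measure.ae_ne volume c)
  have imax : ∀ c : ℝ, IntegrableOn (fun μ : ℝ => max (μ - c) 0) (Set.Icc (-1 : ℝ) 1) := fun c =>
    Continuous.integrableOn_Icc (by fun_prop)
  have A : ∀ c : ℝ, -1 ≤ c → c ≤ 1 → (∫ μ in Set.Icc (-1 : ℝ) 1, μ * g μ) -
      c * (∫ μ in Set.Icc (-1 : ℝ) 1, g μ) < (1 - c) ^ 2 / 2 := by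
    intro c h1 h2
    have d : IntegrableOn (fun μ => μ * g μ - c * g μ) (Set.Icc (-1 : ℝ) 1) := im.sub (ig.const_mul c)
    have := aux_pos (fun μ => max (μ - c) 0 - (μ * g μ - c * g μ))
      ((imax c).sub (im.sub (ig.const_mul c))) (by
        filter_upwards [hb, key c] with x hx hne
        rcases lt_or_gt_of_ne hne with h | h
        · have := le_max_right (x - c) 0
          nlinarith [mul_pos (sub_pos.2 h) hx.1]
        · have := le_max_left (x - c) 0
          nlinarith [mul_pos (sub_pos.2 h) (sub_pos.2 hx.2)])
    rw [integral_sub (imax c) d, integral_sub im (ig.const_mul c),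
      integral_const_mul, aux_max c h1 h2] at this
    linarith
  have B : ∀ c : ℝ, -1 ≤ c → c ≤ 1 → c * (∫ μ in Set.Icc (-1 : ℝ) 1, g μ) -
      (∫ μ in Set.Icc (-1 : ℝ) 1, μ * g μ) < (1 + c) ^ 2 / 2 := by
    intro c h1 h2
    have ic : IntegrableOn (fun _ => c) (Set.Icc (-1 : ℝ) 1) := by simp
    have d : IntegrableOn (fun μ => μ * g μ - c * g μ) (Set.Icc (-1 : ℝ) 1) := im.sub (ig.const_mul c)
    have d1 : IntegrableOn (fun μ => μ - c) (Set.Icc (-1 : ℝ) 1) := ix.sub ic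
    have d2 : IntegrableOn (fun μ => max (μ - c) 0 - (μ - c)) (Set.Icc (-1 : ℝ) 1) := (imax c).sub d1
    have := aux_pos (fun μ => (max (μ - c) 0 - (μ - c)) + (μ * g μ - c * g μ))
      (((imax c).sub (ix.sub ic)).add (im.sub (ig.const_mul c))) (by
        filter_upwards [hb, key c] with x hx hne
        rcases lt_or_gt_of_ne hne with h | h
        · have := le_max_right (x - c) 0
          nlinarith [mul_pos (sub_pos.2 h) (sub_pos.2 hx.2)]
        · have := le_max_left (x - c) 0
          nlinarith [mul_pos (sub_pos.2 h) hx.1])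
    rw [integral_add d2 d,
      integral_sub (imax c) d1, integral_sub ix ic, integral_sub im (ig.const_mul c),
      integral_const_mul, aux_max c h1 h2, ex] at this
    have ec : ∫ μ in Set.Icc (-1 : ℝ) 1, c = 2 * c := by simp; norm_num
    rw [ec] at this
    linarith
  generalize (∫ μ in Set.Icc (-1 : ℝ) 1, g μ) = J at *
  generalize (∫ μ in Set.Icc (-1 : ℝ) 1, μ * g μ) = H at *
  refine ⟨by simpa using hJ0, by simp only; linarith, ?_⟩
  have a := A (1 - J) (by linarith) (by linarith)
  have b := B (J - 1) (by linarith) (by linarith)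
  simp only
  rw [abs_lt]
  constructor <;> nlinarith

theorem sum_flux_splittings_realizable
    (f₁ f₂ : ℝ → ℝ) (hf₁ : Measurable f₁) (hf₂ : Measurable f₂)
    (hbounds₁ : ∀ᵐ μ ∂(volume.restrict (Set.Icc (-1 : ℝ) 1)), 0 < f₁ μ ∧ f₁ μ < 1)
    (hbounds₂ : ∀ᵐ μ ∂(volume.restrict (Set.Icc (-1 : ℝ) 1)), 0 < f₂ μ ∧ f₂ μ < 1)
    (J₁ H₁ K₁ J₂ H₂ K₂ : ℝ)
    (hJ₁ : J₁ = (1 / 2) * ∫ μ in Set.Icc (-1 : ℝ) 1, f₁ μ)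
    (hH₁ : H₁ = (1 / 2) * ∫ μ in Set.Icc (-1 : ℝ) 1, μ * f₁ μ)
    (hK₁ : K₁ = (1 / 2) * ∫ μ in Set.Icc (-1 : ℝ) 1, μ ^ 2 * f₁ μ)
    (hJ₂ : J₂ = (1 / 2) * ∫ μ in Set.Icc (-1 : ℝ) 1, f₂ μ)
    (hH₂ : H₂ = (1 / 2) * ∫ μ in Set.Icc (-1 : ℝ) 1, μ * f₂ μ)
    (hK₂ : K₂ = (1 / 2) * ∫ μ in Set.Icc (-1 : ℝ) 1, μ ^ 2 * f₂ μ) :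
    ((J₁ + H₁) / 2 + (J₂ - H₂) / 2, (H₁ + K₁) / 2 + (H₂ - K₂) / 2) ∈ realizableSet₁ := by
  have ii : ∀ f : ℝ → ℝ, Measurable f →
      (∀ᵐ μ ∂(volume.restrict (Set.Icc (-1 : ℝ) 1)), 0 < f μ ∧ f μ < 1) →
      IntegrableOn f (Set.Icc (-1 : ℝ) 1) := by
    intro f hf hb
    refine Measure.integrableOn_of_bounded (M := 1) (by simp) hf.aestronglyMeasurable ?_
    filter_upwards [hb] with x hx
    rw [Real.norm_eq_abs, abs_of_pos hx.1]
    exact hx.2.le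
  have i1 := ii f₁ hf₁ hbounds₁
  have i2 := ii f₂ hf₂ hbounds₂
  have m1 : IntegrableOn (fun μ => μ * f₁ μ) (Set.Icc (-1 : ℝ) 1) :=
    i1.continuousOn_mul continuousOn_id isCompact_Icc
  have m2 : IntegrableOn (fun μ => μ * f₂ μ) (Set.Icc (-1 : ℝ) 1) :=
    i2.continuousOn_mul continuousOn_id isCompact_Icc
  have q1 : IntegrableOn (fun μ => μ ^ 2 * f₁ μ) (Set.Icc (-1 : ℝ) 1) :=
    i1.continuousOn_mul (continuousOn_id.pow 2) isCompact_Icc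
  have q2 : IntegrableOn (fun μ => μ ^ 2 * f₂ μ) (Set.Icc (-1 : ℝ) 1) :=
    i2.continuousOn_mul (continuousOn_id.pow 2) isCompact_Icc
  have s1 : IntegrableOn (fun μ => f₁ μ + μ * f₁ μ) (Set.Icc (-1 : ℝ) 1) := i1.add m1
  have s2 : IntegrableOn (fun μ => f₂ μ - μ * f₂ μ) (Set.Icc (-1 : ℝ) 1) := i2.sub m2
  have t1 : IntegrableOn (fun μ => μ * f₁ μ + μ ^ 2 * f₁ μ) (Set.Icc (-1 : ℝ) 1) := m1.add q1
  have t2 : IntegrableOn (fun μ => μ * f₂ μ - μ ^ 2 * f₂ μ) (Set.Icc (-1 : ℝ) 1) := m2.sub q2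
  have := aux_real (fun μ => (1 / 2) * ((f₁ μ + μ * f₁ μ) + (f₂ μ - μ * f₂ μ)))
    (by fun_prop) (by
      filter_upwards [hbounds₁, hbounds₂, ae_restrict_mem measurableSet_Icc] with x h1 h2 hx
      obtain ⟨hx1, hx2⟩ := hx
      have a := mul_nonneg (by linarith : 0 ≤ 1 + x) h1.1.le
      have b := mul_nonneg (by linarith : 0 ≤ 1 - x) h2.1.le
      have a' := mul_nonneg (by linarith : 0 ≤ 1 + x) (sub_nonneg.2 h1.2.le)
      have b' := mul_nonneg (by linarith : 0 ≤ 1 - x) (sub_nonneg.2 h2.2.le)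
      rcases le_total 0 x with h | h
      · have c := mul_pos (by linarith : 0 < 1 + x) h1.1
        have c' := mul_pos (by linarith : 0 < 1 + x) (sub_pos.2 h1.2)
        constructor <;> nlinarith
      · have c := mul_pos (by linarith : 0 < 1 - x) h2.1
        have c' := mul_pos (by linarith : 0 < 1 - x) (sub_pos.2 h2.2)
        constructor <;> nlinarith)
  convert this using 2
  · rw [integral_const_mul, integral_add s1 s2, integral_add i1 m1,
      integral_sub i2 m2, hJ₁, hH₁, hJ₂, hH₂]
    ring
  · have e : (fun μ => μ * ((1 / 2) * ((f₁ μ + μ * f₁ μ) + (f₂ μ - μ * f₂ μ)))) =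
        fun μ => (1 / 2) * ((μ * f₁ μ + μ ^ 2 * f₁ μ) + (μ * f₂ μ - μ ^ 2 * f₂ μ)) := by
      funext x; ring
    rw [e, integral_const_mul, integral_add t1 t2, integral_add m1 q1,
      integral_sub m2 q2, hH₁, hK₁, hH₂, hK₂]
    ring
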